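/- There exist constants c > 1 and C > 0 such that for every ε > 0, every L that is a power of 2 with ℓ = log L, and all integers m, n, d with m ≥ c·log(d/ε) and d ≥ c·log(n/ε), there exists a function NIPM : ({0,1}^m)^L × {0,1}^n × ({0,1}^d)^ℓ → {0,1}^m with the following property. Let (V, V', X, X', Y, Y') be jointly distributed random variables where V, V' take values in L×m boolean matrices and X, X' in {0,1}^n, and suppose: every row V_i of V is uniform on {0,1}^m; there exists h ∈ [L] such that (V_h, V'_h) = (U_m, V'_h); H∞(X) ≥ 6m; there are deterministic functions producing (Y_1, …, Y_ℓ) from Y and (Y'_1, …, Y'_ℓ) from Y', with each Y_j, Y'_j taking values in {0,1}^d, satisfying the look-ahead property: for every j ∈ [ℓ], (Y_j, Y_1, Y'_1, …, Y_{j−1}, Y'_{j−1}) = (U_d, Y_1, Y'_1, …, Y_{j−1}, Y'_{j−1}); and (V, V', X, X') is independent of (Y, Y'). Then, writing W = NIPM(V, X, Y_1, …, Y_ℓ) and W' = NIPM(V', X', Y'_1, …, Y'_ℓ), it holds that (W, W', Y, Y') ≈_{C·L·ε} (U_m, W', Y, Y'). -/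

import Mathlib

set_option synthInstance.maxSize 2048
set_option synthInstance.maxHeartbeats 1000000
set_option maxHeartbeats 1000000

noncomputable section

/-- Bit strings of length `n`. -/
abbrev BS (n : ℕ) : Type := Fin n → Bool

/-- Logarithm base 2. -/
def log2 (x : ℝ) : ℝ := Real.logb 2 x

/-- `p` is a probability distribution on the finite type `α`. -/
def IsDist {α : Type*} [Fintype α] (p : α → ℝ) : Prop :=
  (∀ a, 0 ≤ p a) ∧ ∑ a, p a = 1

/-- Statistical (total variation) distance between two distributions on a finite type. -/
def sd {α : Type*} [Fintype α] (p q : α → ℝ) : ℝ :=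
  (∑ a, |p a - q a|) / 2

/-- Pushforward of a distribution along a function (the distribution of `f(X)` for `X ~ p`). -/
def distMap {α β : Type*} [Fintype α] [DecidableEq β] (f : α → β) (p : α → ℝ) : β → ℝ :=
  fun b => ∑ a, if f a = b then p a else 0

/-- Product (independent joint) distribution. -/
def prodDist {α β : Type*} (p : α → ℝ) (q : β → ℝ) : α × β → ℝ :=
  fun x => p x.1 * q x.2

/-- Uniform distribution on a finite type. -/
def unifDist (α : Type*) [Fintype α] : α → ℝ :=
  fun _ => 1 / (Fintype.card α : ℝ)

/-- The distribution `p` has min-entropy at least `k` (k real, logs base 2). -/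
def minEntropyGe {α : Type*} (p : α → ℝ) (k : ℝ) : Prop :=
  ∀ a, p a ≤ (2 : ℝ) ^ (-k)


section helpers
open Finset

lemma resample {J B : Type} [Fintype J] [DecidableEq J] [Fintype B] [DecidableEq B]
    (j : J) (Φ : (J → B) → ℝ) :
    ∑ F : J → B, ∑ b : B, Φ (Function.update F j b) = Fintype.card B * ∑ F : J → B, Φ F := by
  have h : ∑ p : (J → B) × B, Φ (Function.update p.1 j p.2) = ∑ p : (J → B) × B, Φ p.1 := by
    let e : (J → B) × B → (J → B) × B := fun p => (Function.update p.1 j p.2, p.1 j)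
    have he : Function.Involutive e := by
      rintro ⟨F, b⟩
      simp [e]
    exact Equiv.sum_comp he.toPerm (fun p : (J → B) × B => Φ p.1)
  rw [Fintype.sum_prod_type, Fintype.sum_prod_type] at h
  rw [h]
  simp [Finset.mul_sum]

lemma mgf_prod {J Q B : Type} [Fintype J] [DecidableEq J] [Fintype B] [DecidableEq B] [Nonempty B]
    [DecidableEq Q] (e f : Q → J) (he : Function.Injective e) (hf : ∀ q q', f q ≠ e q')
    (φ : Q → B → B → ℝ) (hφ : ∀ q b b', 0 ≤ φ q b b') (c : ℝ)
    (hc : ∀ q b', ∑ b, φ q b b' ≤ c * Fintype.card B) (s : Finset Q) :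
    ∑ F : J → B, ∏ q ∈ s, φ q (F (e q)) (F (f q)) ≤ c ^ s.card * (Fintype.card B : ℝ) ^ Fintype.card J := by
  have hB : (0 : ℝ) < Fintype.card B := by exact_mod_cast Fintype.card_pos
  induction s using Finset.induction_on with
  | empty => simp
  | insert q s hq ih =>
    have hc0 : 0 ≤ c := by
      obtain ⟨b⟩ := ‹Nonempty B›
      have := (Finset.sum_nonneg (fun b' _ => hφ q b' b)).trans (hc q b)
      exact nonneg_of_mul_nonneg_left this hB
    have h1 := resample (B := B) (e q) (fun F => ∏ q ∈ insert q s, φ q (F (e q)) (F (f q)))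
    have h2 : ∀ F : J → B, ∑ b : B, ∏ q' ∈ insert q s,
        φ q' (Function.update F (e q) b (e q')) (Function.update F (e q) b (f q'))
        ≤ c * Fintype.card B * ∏ q ∈ s, φ q (F (e q)) (F (f q)) := by
      intro F
      have h3 : ∀ b : B, ∏ q' ∈ insert q s,
        φ q' (Function.update F (e q) b (e q')) (Function.update F (e q) b (f q'))
          = φ q b (F (f q)) * ∏ q ∈ s, φ q (F (e q)) (F (f q)) := by
        intro b
        rw [Finset.prod_insert hq]
        congr 1
        · rw [Function.update_self, Function.update_of_ne (hf _ _)]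
        · apply Finset.prod_congr rfl
          intro q' hq'
          rw [Function.update_of_ne (hf _ _), Function.update_of_ne]
          intro h
          exact hq (he h ▸ hq')
      simp_rw [h3]
      rw [← Finset.sum_mul]
      exact mul_le_mul_of_nonneg_right (hc _ _) (Finset.prod_nonneg (fun _ _ => hφ _ _ _))
    have h4 := Finset.sum_le_sum (s := Finset.univ) (fun F _ => h2 F)
    rw [h1, ← Finset.mul_sum] at h4
    rw [Finset.card_insert_of_notMem hq, pow_succ]
    have h5 : ∑ F : J → B, ∏ q ∈ insert q s, φ q (F (e q)) (F (f q)) ≤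
        c * ∑ F : J → B, ∏ q ∈ s, φ q (F (e q)) (F (f q)) := by
      apply le_of_mul_le_mul_left _ hB
      calc _ ≤ _ := h4
        _ = _ := by ring
    calc _ ≤ _ := h5
      _ ≤ c * (c ^ s.card * (Fintype.card B : ℝ) ^ Fintype.card J) := mul_le_mul_of_nonneg_left ih hc0
      _ = _ := by ring

/-- centered test -/
def ctest {B : Type} [Fintype B] (T : B → B → Bool) (b b' : B) : ℝ :=
  (if T b b' then 1 else 0) - (∑ w, if T w b' then (1 : ℝ) else 0) / Fintype.card B

lemma ctest_avg {B : Type} [Fintype B] (T : B → B → Bool) (b' : B) :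
    0 ≤ (∑ w, if T w b' then (1 : ℝ) else 0) / Fintype.card B ∧
    (∑ w, if T w b' then (1 : ℝ) else 0) / Fintype.card B ≤ 1 := by
  constructor
  · apply div_nonneg
    · apply Finset.sum_nonneg; intro i _; split_ifs <;> norm_num
    · positivity
  · apply div_le_one_of_le₀
    · calc _ ≤ ∑ w : B, (1 : ℝ) := by
            apply Finset.sum_le_sum; intro i _; split_ifs <;> norm_num
        _ = _ := by simp
    · positivity

lemma ctest_le {B : Type} [Fintype B] (T : B → B → Bool) (b b' : B) : ctest T b b' ≤ 1 := by
  have := ctest_avg T b'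
  unfold ctest
  split_ifs <;> linarith

lemma ctest_abs {B : Type} [Fintype B] (T : B → B → Bool) (b b' : B) : |ctest T b b'| ≤ 1 := by
  have := ctest_avg T b'
  unfold ctest
  rw [abs_le]
  split_ifs <;> constructor <;> linarith

lemma ctest_sum {B : Type} [Fintype B] [Nonempty B] (T : B → B → Bool) (b' : B) :
    ∑ b, ctest T b b' = 0 := by
  have hB : (Fintype.card B : ℝ) ≠ 0 := by exact_mod_cast Fintype.card_ne_zero
  unfold ctest
  rw [Finset.sum_sub_distrib]
  simp only [Finset.sum_const, Finset.card_univ, nsmul_eq_mul]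
  field_simp
  ring

lemma ctest_mgf {B : Type} [Fintype B] [Nonempty B] (T : B → B → Bool) (b' : B) (l : ℝ)
    (h0 : 0 ≤ l) (h1 : l ≤ 1) :
    ∑ b, Real.exp (l * ctest T b b') ≤ Real.exp (l ^ 2) * Fintype.card B := by
  have h : ∀ b, Real.exp (l * ctest T b b') ≤ (1 + l ^ 2) + l * ctest T b b' := by
    intro b
    have ha := ctest_abs T b b'
    have hx : |l * ctest T b b'| ≤ 1 := by
      rw [abs_mul, abs_of_nonneg h0]
      exact mul_le_one₀ h1 (abs_nonneg _) ha
    have h2 := (abs_le.1 (Real.abs_exp_sub_one_sub_id_le hx)).2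
    have h3 : (l * ctest T b b') ^ 2 ≤ l ^ 2 := by
      rw [mul_pow]
      have : (ctest T b b') ^ 2 ≤ 1 := by
        rw [← sq_abs]; exact pow_le_one₀ (abs_nonneg _) ha
      nlinarith [sq_nonneg l]
    linarith
  calc _ ≤ ∑ b, ((1 + l ^ 2) + l * ctest T b b') := Finset.sum_le_sum (fun b _ => h b)
    _ = (1 + l ^ 2) * Fintype.card B := by
        rw [Finset.sum_add_distrib, ← Finset.mul_sum, ctest_sum]
        simp; ring
    _ ≤ _ := by
        apply mul_le_mul_of_nonneg_right _ (by positivity)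
        linarith [Real.add_one_le_exp (l ^ 2)]

/-- the deviation for a pair of sources -/
def dev {U S B : Type} [Fintype S] [Fintype B] (F : U × S → B) (g : S → S) (T : S → B → B → Bool)
    (u u' : U) : ℝ := ∑ y, ctest (T y) (F (u, y)) (F (u', g y))

theorem exists_F {U S B : Type} [Fintype U] [Fintype S] [Fintype B] [Nonempty B]
    [DecidableEq U] [DecidableEq S] [DecidableEq B]
    (ε : ℝ) (h0 : 0 < ε) (h1 : ε ≤ 1) (K : ℕ)
    (hcount : (Fintype.card ((S → S) × (S → B → B → Bool) × (Fin K → U × U)) : ℝ)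
      < Real.exp (ε ^ 2 / 4 * (K * Fintype.card S))) :
    ∃ F : U × S → B, ∀ (g : S → S) (T : S → B → B → Bool) (v : Fin K → U × U),
      Function.Injective (fun k => (v k).1) → (∀ k k', (v k).2 ≠ (v k').1) →
      ∑ k, dev F g T (v k).1 (v k).2 ≤ ε * (K * Fintype.card S) := by
  classical
  by_contra hcon
  push Not at hcon
  set E : ℝ := K * Fintype.card S with hE
  let I := (S → S) × (S → B → B → Bool) × (Fin K → U × U)
  let ok : I → Prop := fun c => Function.Injective (fun k => (c.2.2 k).1) ∧
    (∀ k k', (c.2.2 k).2 ≠ (c.2.2 k').1)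
  let st : I → (U × S → B) → ℝ := fun c F => ∑ k, dev F c.1 c.2.1 (c.2.2 k).1 (c.2.2 k).2
  let G : I → (U × S → B) → ℝ := fun c F =>
    if ok c then Real.exp (ε / 2 * (st c F - ε * E)) else 0
  have hG0 : ∀ c F, 0 ≤ G c F := by
    intro c F
    simp only [G]
    split_ifs
    · positivity
    · exact le_rfl
  have hA : ∀ F : U × S → B, 1 ≤ ∑ c, G c F := by
    intro F
    obtain ⟨g, T, v, hv1, hv2, hlt⟩ := hcon F
    have : 1 ≤ G (g, T, v) F := by
      have hok : ok (g, T, v) := ⟨hv1, hv2⟩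
      simp only [G, if_pos hok]
      apply Real.one_le_exp
      apply mul_nonneg (by linarith)
      simp only [st]; linarith
    exact this.trans (Finset.single_le_sum (fun c _ => hG0 c F) (Finset.mem_univ (g, T, v)))
  set R : ℝ := (Fintype.card B : ℝ) ^ Fintype.card (U × S) with hR
  have hRpos : 0 < R := by
    have hB : (0 : ℝ) < Fintype.card B := by exact_mod_cast Fintype.card_pos
    positivity
  have hB : ∀ c, ∑ F, G c F ≤ Real.exp (-(ε ^ 2 / 4 * E)) * R := by
    intro c
    by_cases hok : ok c
    · simp only [G, if_pos hok]
      have key := mgf_prod (J := U × S) (Q := Fin K × S) (B := B)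
        (fun q => ((c.2.2 q.1).1, q.2)) (fun q => ((c.2.2 q.1).2, c.1 q.2))
        (by
          rintro ⟨k, y⟩ ⟨k', y'⟩ h
          simp only [Prod.mk.injEq] at h
          have := hok.1 h.1
          simp [this, h.2])
        (by
          rintro ⟨k, y⟩ ⟨k', y'⟩ h
          simp only [Prod.mk.injEq] at h
          exact hok.2 _ _ h.1)
        (fun q b b' => Real.exp (ε / 2 * ctest (c.2.1 q.2) b b'))
        (fun _ _ _ => by positivity) (Real.exp ((ε / 2) ^ 2))
        (fun q b' => ctest_mgf _ _ _ (by linarith) (by linarith)) Finset.univ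
      have heq : ∀ F : U × S → B, Real.exp (ε / 2 * (st c F - ε * E)) =
          Real.exp (-(ε / 2 * (ε * E))) * ∏ q : Fin K × S,
            Real.exp (ε / 2 * ctest (c.2.1 q.2) (F ((c.2.2 q.1).1, q.2)) (F ((c.2.2 q.1).2, c.1 q.2))) := by
        intro F
        rw [← Real.exp_sum, ← Real.exp_add, ← Finset.mul_sum, Fintype.sum_prod_type]
        congr 1
        simp only [st, dev]
        ring
      simp_rw [heq]
      rw [← Finset.mul_sum]
      calc _ ≤ Real.exp (-(ε / 2 * (ε * E))) * _ := mul_le_mul_of_nonneg_left key (by positivity)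
        _ = _ := by
          rw [← Real.exp_nat_mul, ← mul_assoc, ← Real.exp_add]
          congr 2
          simp only [Finset.card_univ, Fintype.card_prod, Fintype.card_fin, Nat.cast_mul]
          rw [← hE]; ring
    · simp only [G, if_neg hok]
      simp; positivity
  have hC : R ≤ ∑ c : I, Real.exp (-(ε ^ 2 / 4 * E)) * R := by
    calc R = ∑ F : U × S → B, (1 : ℝ) := by simp [hR]
      _ ≤ ∑ F, ∑ c, G c F := Finset.sum_le_sum (fun F _ => hA F)
      _ = ∑ c, ∑ F, G c F := Finset.sum_comm
      _ ≤ _ := Finset.sum_le_sum (fun c _ => hB c)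
  rw [Finset.sum_const, nsmul_eq_mul, Finset.card_univ, ← mul_assoc] at hC
  have hD : (Fintype.card I : ℝ) * Real.exp (-(ε ^ 2 / 4 * E)) < 1 := by
    rw [Real.exp_neg, ← div_eq_mul_inv, div_lt_one (by positivity)]
    exact hcount
  nlinarith

lemma distMap_sum {α β : Type*} [Fintype α] [Fintype β] [DecidableEq β] (f : α → β) (p : α → ℝ)
    (φ : β → ℝ) : ∑ b, distMap f p b * φ b = ∑ a, p a * φ (f a) := by
  unfold distMap
  simp_rw [Finset.sum_mul]
  rw [Finset.sum_comm]
  apply Finset.sum_congr rfl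
  intro a _
  simp [ite_mul]

lemma distMap_eq {α β : Type*} [Fintype α] [DecidableEq β] (f : α → β) (p : α → ℝ) (b : β) :
    distMap f p b = ∑ a, p a * (if f a = b then 1 else 0) := by
  simp [distMap]

lemma indep_sum {Ω A T : Type*} [Fintype Ω] [Fintype A] [DecidableEq A] [Fintype T] [DecidableEq T]
    (μ : Ω → ℝ) (f : Ω → A) (g : Ω → T)
    (hind : distMap (fun ω => (f ω, g ω)) μ = prodDist (distMap f μ) (distMap g μ))
    (φ : A → ℝ) (t : T) :
    ∑ ω, μ ω * (φ (f ω) * (if g ω = t then 1 else 0)) = (∑ ω, μ ω * φ (f ω)) * distMap g μ t := by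
  have h1 := distMap_sum (fun ω => (f ω, g ω)) μ (fun x => φ x.1 * (if x.2 = t then 1 else 0))
  rw [← h1, hind, Fintype.sum_prod_type]
  simp only [prodDist]
  rw [← distMap_sum f μ φ, Finset.sum_mul]
  apply Finset.sum_congr rfl
  intro a _
  simp
  ring

lemma sd_formula {Ω A τ B : Type} [Fintype Ω] [Fintype A] [DecidableEq A] [Fintype τ]
    [DecidableEq τ] [Fintype B] [DecidableEq B]
    (μ : Ω → ℝ) (f : Ω → A) (Y Y' : Ω → τ)
    (hind : distMap (fun ω => (f ω, (Y ω, Y' ω))) μ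
      = prodDist (distMap f μ) (distMap (fun ω => (Y ω, Y' ω)) μ))
    (hβ : ∀ t, 0 ≤ distMap (fun ω => (Y ω, Y' ω)) μ t)
    (W W' : A → τ → B) :
    sd (distMap (fun ω => (W (f ω) (Y ω), W' (f ω) (Y' ω), Y ω, Y' ω)) μ)
      (distMap (fun p : B × Ω => (p.1, W' (f p.2) (Y' p.2), Y p.2, Y' p.2))
        (prodDist (unifDist B) μ)) =
    (∑ t : τ × τ, distMap (fun ω => (Y ω, Y' ω)) μ t * ∑ w : B × B,
      |∑ ω, μ ω * (((if W (f ω) t.1 = w.1 then 1 else 0) - 1 / (Fintype.card B : ℝ)) *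
        (if W' (f ω) t.2 = w.2 then 1 else 0))|) / 2 := by
  unfold sd
  congr 1
  have e : (∑ t : τ × τ, distMap (fun ω => (Y ω, Y' ω)) μ t * ∑ w : B × B,
      |∑ ω, μ ω * (((if W (f ω) t.1 = w.1 then 1 else 0) - 1 / (Fintype.card B : ℝ)) *
        (if W' (f ω) t.2 = w.2 then 1 else 0))|) =
      ∑ w : B, ∑ w' : B, ∑ t : τ × τ, |(∑ ω, μ ω * (((if W (f ω) t.1 = w then 1 else 0) - 1 / (Fintype.card B : ℝ)) *
        (if W' (f ω) t.2 = w' then 1 else 0))) * distMap (fun ω => (Y ω, Y' ω)) μ t| := by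
    simp_rw [Finset.mul_sum]
    rw [Finset.sum_comm, Fintype.sum_prod_type]
    simp_rw [abs_mul, abs_of_nonneg (hβ _), mul_comm]
  rw [e, Fintype.sum_prod_type]
  apply Finset.sum_congr rfl
  intro w _
  rw [Fintype.sum_prod_type]
  apply Finset.sum_congr rfl
  intro w' _
  apply Finset.sum_congr rfl
  rintro ⟨t, t'⟩ _
  congr 1
  rw [← indep_sum μ f (fun ω => (Y ω, Y' ω)) hind (fun a => ((if W a t = w then 1 else 0) - 1 / (Fintype.card B : ℝ)) *
        (if W' a t' = w' then 1 else 0)) (t, t')]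
  rw [distMap_eq, distMap_eq, Fintype.sum_prod_type, Finset.sum_comm, ← Finset.sum_sub_distrib]
  apply Finset.sum_congr rfl
  intro ω _
  simp only [prodDist, unifDist, Prod.mk.injEq]
  by_cases h : Y ω = t ∧ Y' ω = t'
  · obtain ⟨rfl, rfl⟩ := h
    by_cases h' : W' (f ω) (Y' ω) = w'
    · simp [h', Finset.sum_ite_eq']
      split_ifs <;> ring
    · simp [h']
  · have : ∀ (P Q : Prop), ¬ (P ∧ Q ∧ Y ω = t ∧ Y' ω = t') := fun P Q hh => h hh.2.2
    simp [this, h]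

/-- total variation as a test -/
lemma abs_test {B : Type} [Fintype B] [DecidableEq B] [Nonempty B] {Ω : Type} [Fintype Ω] (μ : Ω → ℝ)
    (a a' : Ω → B) :
    ∃ T : B → B → Bool, (∑ w : B × B,
      |∑ ω, μ ω * (((if a ω = w.1 then 1 else 0) - 1 / (Fintype.card B : ℝ)) *
        (if a' ω = w.2 then 1 else 0))|) / 2 = ∑ ω, μ ω * ctest T (a ω) (a' ω) := by
  classical
  have hB : (Fintype.card B : ℝ) ≠ 0 := by exact_mod_cast Fintype.card_ne_zero
  set s : B × B → ℝ := fun w => ∑ ω, μ ω * (((if a ω = w.1 then 1 else 0) - 1 / (Fintype.card B : ℝ)) *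
        (if a' ω = w.2 then 1 else 0)) with hs
  refine ⟨fun w w' => decide (0 ≤ s (w, w')), ?_⟩
  have h0 : ∑ w, s w = 0 := by
    simp only [hs]
    rw [Finset.sum_comm]
    apply Finset.sum_eq_zero
    intro ω _
    rw [← Finset.mul_sum, Fintype.sum_prod_type]
    simp only [← Finset.mul_sum, ← Finset.sum_mul, Finset.sum_sub_distrib]
    simp [hB]
  have h1 : ∀ x : ℝ, |x| = 2 * (x * if 0 ≤ x then 1 else 0) - x := by
    intro x
    split_ifs with h
    · rw [abs_of_nonneg h]; ring
    · rw [abs_of_neg (not_le.1 h)]; ring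
  have h2 : (∑ w, |s w|) / 2 = ∑ w, s w * if 0 ≤ s w then 1 else 0 := by
    rw [Finset.sum_congr rfl (fun w _ => h1 (s w)), Finset.sum_sub_distrib, h0, ← Finset.mul_sum]
    ring
  change (∑ w, |s w|) / 2 = _
  rw [h2]
  have h3 : ∀ w, s w * (if 0 ≤ s w then (1 : ℝ) else 0) = ∑ ω, μ ω * ((((if a ω = w.1 then 1 else 0) - 1 / (Fintype.card B : ℝ)) *
        (if a' ω = w.2 then 1 else 0)) * (if 0 ≤ s w then (1 : ℝ) else 0)) := by
    intro w
    conv_lhs => rw [hs]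
    simp only
    rw [Finset.sum_mul]
    apply Finset.sum_congr rfl
    intro ω _
    ring
  simp_rw [h3]
  rw [Finset.sum_comm]
  apply Finset.sum_congr rfl
  intro ω _
  rw [← Finset.mul_sum]
  congr 1
  unfold ctest
  rw [Fintype.sum_prod_type_right]
  simp only [mul_assoc]
  have h4 : ∀ (w' : B), ∑ w : B, ((if a ω = w then 1 else 0) - 1 / (Fintype.card B : ℝ)) *
        ((if a' ω = w' then 1 else 0) * (if 0 ≤ s (w, w') then (1 : ℝ) else 0)) =
        if a' ω = w' then ∑ w : B, ((if a ω = w then 1 else 0) - 1 / (Fintype.card B : ℝ)) * 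
          (if 0 ≤ s (w, w') then (1 : ℝ) else 0) else 0 := by
    intro w'
    split_ifs <;> simp
  simp_rw [h4]
  rw [Finset.sum_ite_eq]
  simp only [Finset.mem_univ, if_true, sub_mul, Finset.sum_sub_distrib, ← Finset.mul_sum, ite_mul, one_mul, zero_mul,
    Finset.sum_ite_eq, decide_eq_true_eq]
  ring

lemma sd_le_one {α : Type*} [Fintype α] (p q : α → ℝ) (hp : IsDist p) (hq : IsDist q) : sd p q ≤ 1 := by
  unfold sd
  have : ∑ a, |p a - q a| ≤ ∑ a, (p a + q a) := by
    apply Finset.sum_le_sum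
    intro a _
    have := hp.1 a
    have := hq.1 a
    rw [abs_le]; constructor <;> linarith
  rw [Finset.sum_add_distrib, hp.2, hq.2] at this
  linarith

lemma isDist_distMap {α β : Type*} [Fintype α] [Fintype β] [DecidableEq β] (f : α → β) (p : α → ℝ)
    (hp : IsDist p) : IsDist (distMap f p) := by
  constructor
  · intro b
    apply Finset.sum_nonneg
    intro a _
    split_ifs
    · exact hp.1 a
    · exact le_rfl
  · have := distMap_sum f p (fun _ => 1)
    simp only [mul_one] at this
    rw [this, hp.2]

lemma isDist_unif {α : Type*} [Fintype α] [Nonempty α] : IsDist (unifDist α) := by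
  have hB : (Fintype.card α : ℝ) ≠ 0 := by exact_mod_cast Fintype.card_ne_zero
  constructor
  · intro a; unfold unifDist; positivity
  · simp [unifDist, hB]

lemma isDist_prod {α β : Type*} [Fintype α] [Fintype β] (p : α → ℝ) (q : β → ℝ)
    (hp : IsDist p) (hq : IsDist q) : IsDist (prodDist p q) := by
  constructor
  · intro x; exact mul_nonneg (hp.1 _) (hq.1 _)
  · rw [Fintype.sum_prod_type]
    simp [prodDist, ← Finset.mul_sum, hp.2, hq.2]

theorem analysis {L m n d K : ℕ} (ε : ℝ) (hε : 0 < ε) (hK : 0 < K)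
    (F : ((Fin L → BS m) × BS n) × BS d → BS m)
    (hF : ∀ (g : BS d → BS d) (T : BS d → BS m → BS m → Bool)
      (v : Fin K → ((Fin L → BS m) × BS n) × ((Fin L → BS m) × BS n)),
      Function.Injective (fun k => (v k).1) → (∀ k k', (v k).2 ≠ (v k').1) →
      ∑ k, dev F g T (v k).1 (v k).2 ≤ ε * (K * Fintype.card (BS d)))
    {Ω τ : Type} [Fintype Ω] [Fintype τ] [DecidableEq τ] (μ : Ω → ℝ) (hμ : IsDist μ)
    (V V' : Ω → Fin L → BS m) (X X' : Ω → BS n) (Y Y' : Ω → τ) (y y' : τ → BS d)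
    (h : Fin L) (hh : distMap (fun ω => (V ω h, V' ω h)) μ
                  = prodDist (unifDist (BS m)) (distMap (fun ω => V' ω h) μ))
    (hX : minEntropyGe (distMap X μ) (6 * m))
    (hy : ∀ s, distMap (fun ω => y (Y ω)) μ s = 1 / (Fintype.card (BS d) : ℝ))
    (hind : distMap (fun ω => ((V ω, V' ω, X ω, X' ω), (Y ω, Y' ω))) μ
                  = prodDist (distMap (fun ω => (V ω, V' ω, X ω, X' ω)) μ)
                      (distMap (fun ω => (Y ω, Y' ω)) μ)) :
    sd (distMap (fun ω => (F ((V ω, X ω), y (Y ω)), F ((V' ω, X' ω), y' (Y' ω)), Y ω, Y' ω)) μ)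
      (distMap (fun p : BS m × Ω => (p.1, F ((V' p.2, X' p.2), y' (Y' p.2)), Y p.2, Y' p.2))
        (prodDist (unifDist (BS m)) μ)) ≤
      ε + 1 / 2 ^ m + (m * 2) * (K * (2 : ℝ) ^ (-(6 * m : ℝ))) := by
  classical
  let β := distMap (fun ω => (Y ω, Y' ω)) μ
  have hβ : ∀ t, 0 ≤ β t := (isDist_distMap _ μ hμ).1
  have hform := sd_formula (B := BS m) μ (fun ω => (V ω, V' ω, X ω, X' ω)) Y Y' hind hβ
    (fun a t => F ((a.1, a.2.2.1), y t)) (fun a t => F ((a.2.1, a.2.2.2), y' t))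
  let e : BS d → BS d → ℝ := fun s s' => (∑ w : BS m × BS m,
      |∑ ω, μ ω * (((if F ((V ω, X ω), s) = w.1 then 1 else 0) - 1 / (Fintype.card (BS m) : ℝ)) *
        (if F ((V' ω, X' ω), s') = w.2 then 1 else 0))|) / 2
  have hg : ∀ s, ∃ s', ∀ s'', e s s'' ≤ e s s' := fun s => Finite.exists_max (e s)
  choose g hg using hg
  have hT : ∀ s, ∃ T : BS m → BS m → Bool, e s (g s) =
      ∑ ω, μ ω * ctest T (F ((V ω, X ω), s)) (F ((V' ω, X' ω), g s)) :=
    fun s => abs_test μ (fun ω => F ((V ω, X ω), s)) (fun ω => F ((V' ω, X' ω), g s))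
  choose T hT using hT
  set D : ℝ := (Fintype.card (BS d) : ℝ) with hD
  have hDpos : 0 < D := by
    have : 0 < Fintype.card (BS d) := Fintype.card_pos
    rw [hD]; exact_mod_cast this
  have step1 : sd (distMap (fun ω => (F ((V ω, X ω), y (Y ω)), F ((V' ω, X' ω), y' (Y' ω)), Y ω, Y' ω)) μ)
      (distMap (fun p : BS m × Ω => (p.1, F ((V' p.2, X' p.2), y' (Y' p.2)), Y p.2, Y' p.2))
        (prodDist (unifDist (BS m)) μ)) ≤
      ∑ ω, μ ω * (dev F g T (V ω, X ω) (V' ω, X' ω) / D) := by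
    refine hform.le.trans ?_
    calc _ = ∑ t, β t * e (y t.1) (y' t.2) := by
          rw [Finset.sum_div]
          apply Finset.sum_congr rfl
          intro t _
          simp only [e]
          rw [mul_div_assoc]
      _ ≤ ∑ t, β t * e (y t.1) (g (y t.1)) :=
          Finset.sum_le_sum (fun t _ => mul_le_mul_of_nonneg_left (hg _ _) (hβ t))
      _ = ∑ ω, μ ω * e (y (Y ω)) (g (y (Y ω))) := by
          clear_value e
          exact distMap_sum (fun ω => (Y ω, Y' ω)) μ (fun t : τ × τ => e (y t.1) (g (y t.1)))
      _ = ∑ s, distMap (fun ω => y (Y ω)) μ s * e s (g s) := by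
          clear_value e
          exact (distMap_sum (fun ω => y (Y ω)) μ (fun s => e s (g s))).symm
      _ = ∑ s, ∑ ω, 1 / D * (μ ω * ctest (T s) (F ((V ω, X ω), s)) (F ((V' ω, X' ω), g s))) := by
          apply Finset.sum_congr rfl
          intro s _
          rw [hy, hT, Finset.mul_sum]
      _ = _ := by
          rw [Finset.sum_comm]
          apply Finset.sum_congr rfl
          intro ω _
          unfold dev
          rw [← Finset.mul_sum, ← Finset.mul_sum]
          ring
  refine step1.trans ?_
  let Bad : Fin m × Bool → Finset ((Fin L → BS m) × BS n) := fun i =>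
    Finset.univ.filter (fun u => u.1 h i.1 = i.2 ∧ ∃ u' : (Fin L → BS m) × BS n,
      u'.1 h i.1 ≠ i.2 ∧ ε * D < dev F g T u u')
  have hBad : ∀ i, (Bad i).card ≤ K := by
    intro i
    by_contra hlt
    push Not at hlt
    obtain ⟨Z, hZ, hZK⟩ := Finset.exists_subset_card_eq hlt.le
    let q := Z.equivFinOfCardEq hZK
    have hmem : ∀ k, (q.symm k : (Fin L → BS m) × BS n) ∈ Bad i := fun k => hZ (q.symm k).2
    simp only [Bad, Finset.mem_filter, Finset.mem_univ, true_and] at hmem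
    choose h1 u' h2 h3 using hmem
    have := hF g T (fun k => ((q.symm k : (Fin L → BS m) × BS n), u' k))
      (by intro a b hab; exact q.symm.injective (Subtype.ext hab))
      (by
        intro k k' hkk
        apply h2 k
        simp only at hkk
        rw [hkk]; exact h1 k')
    have hlt2 : ∑ k : Fin K, ε * D < ∑ k : Fin K, dev F g T (q.symm k : (Fin L → BS m) × BS n) (u' k) := by
      apply Finset.sum_lt_sum_of_nonempty
      · exact ⟨⟨0, hK⟩, Finset.mem_univ _⟩
      · intro k _; exact h3 k
    simp only [Finset.sum_const, Finset.card_univ, Fintype.card_fin, nsmul_eq_mul] at hlt2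
    simp only at this
    nlinarith
  have hdev1 : ∀ u u', dev F g T u u' ≤ D := by
    intro u u'
    unfold dev
    calc _ ≤ ∑ s : BS d, (1 : ℝ) := Finset.sum_le_sum (fun s _ => ctest_le _ _ _)
      _ = D := by rw [Finset.sum_const, nsmul_eq_mul, mul_one, hD, Finset.card_univ]
  have hpt : ∀ ω, dev F g T (V ω, X ω) (V' ω, X' ω) / D ≤
      ε + (if V ω h = V' ω h then 1 else 0) + ∑ i, (if (V ω, X ω) ∈ Bad i then (1 : ℝ) else 0) := by
    intro ω
    have hle1 : dev F g T (V ω, X ω) (V' ω, X' ω) / D ≤ 1 := (div_le_one hDpos).2 (hdev1 _ _)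
    have hs0 : 0 ≤ ∑ i, (if (V ω, X ω) ∈ Bad i then (1 : ℝ) else 0) :=
      Finset.sum_nonneg (fun i _ => by split_ifs <;> norm_num)
    by_cases hVV : V ω h = V' ω h
    · rw [if_pos hVV]; linarith
    · rw [if_neg hVV]
      by_cases hdv : ε * D < dev F g T (V ω, X ω) (V' ω, X' ω)
      · obtain ⟨i, hi⟩ := Function.ne_iff.1 hVV
        have hb : (V ω, X ω) ∈ Bad (i, V ω h i) := by
          simp only [Bad, Finset.mem_filter, Finset.mem_univ, true_and]
          exact ⟨(V' ω, X' ω), fun hc => hi hc.symm, hdv⟩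
        have := Finset.single_le_sum (f := fun i => (if (V ω, X ω) ∈ Bad i then (1 : ℝ) else 0))
          (fun i _ => by split_ifs <;> norm_num) (Finset.mem_univ (i, V ω h i))
        simp only [if_pos hb] at this
        linarith
      · have : dev F g T (V ω, X ω) (V' ω, X' ω) / D ≤ ε := by
          rw [div_le_iff₀ hDpos]; exact not_lt.1 hdv
        linarith
  have hsum := Finset.sum_le_sum (s := Finset.univ)
    (fun ω _ => mul_le_mul_of_nonneg_left (hpt ω) (hμ.1 ω))
  refine hsum.trans ?_
  simp only [mul_add, Finset.sum_add_distrib]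
  have t1 : ∑ ω, μ ω * ε = ε := by rw [← Finset.sum_mul, hμ.2, one_mul]
  have t2 : ∑ ω, μ ω * (if V ω h = V' ω h then (1 : ℝ) else 0) = 1 / 2 ^ m := by
    rw [← distMap_sum (fun ω => (V ω h, V' ω h)) μ (fun x => if x.1 = x.2 then (1 : ℝ) else 0), hh,
      Fintype.sum_prod_type_right]
    simp only [prodDist, unifDist, mul_ite, mul_one, mul_zero, Finset.sum_ite_eq', Finset.mem_univ, if_true]
    rw [← Finset.mul_sum, (isDist_distMap _ μ hμ).2]
    simp
  have t3 : ∑ ω, μ ω * ∑ i, (if (V ω, X ω) ∈ Bad i then (1 : ℝ) else 0) ≤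
      (m * 2) * (K * (2 : ℝ) ^ (-(6 * m : ℝ))) := by
    simp_rw [Finset.mul_sum]
    rw [Finset.sum_comm]
    calc _ ≤ ∑ i : Fin m × Bool, (K * (2 : ℝ) ^ (-(6 * m : ℝ))) := by
          apply Finset.sum_le_sum
          intro i _
          rw [← distMap_sum (fun ω => (V ω, X ω)) μ (fun u => if u ∈ Bad i then (1 : ℝ) else 0)]
          simp only [mul_ite, mul_one, mul_zero]
          rw [← Finset.sum_filter, Finset.filter_mem_eq_inter, Finset.univ_inter]
          calc _ ≤ ∑ u ∈ Bad i, (2 : ℝ) ^ (-(6 * m : ℝ)) := by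
                apply Finset.sum_le_sum
                intro u _
                refine le_trans ?_ (hX u.2)
                unfold distMap
                apply Finset.sum_le_sum
                intro ω _
                by_cases hu : X ω = u.2
                · rw [if_pos hu]
                  split_ifs
                  · exact le_rfl
                  · exact hμ.1 ω
                · rw [if_neg hu, if_neg]
                  intro hc; exact hu (by rw [← hc])
            _ = (Bad i).card * (2 : ℝ) ^ (-(6 * m : ℝ)) := by rw [Finset.sum_const, nsmul_eq_mul]
            _ ≤ _ := by
                apply mul_le_mul_of_nonneg_right _ (by positivity)
                exact_mod_cast hBad i
      _ = _ := by simp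
  linarith

lemma pow_of_log (x : ℝ) (hx : 0 < x) (m : ℕ) (h : 6 * log2 x ≤ (m : ℝ)) : x ^ 6 ≤ (2 : ℝ) ^ m := by
  unfold log2 at h
  have h2 : Real.logb 2 (x ^ 6) ≤ (m : ℝ) := by
    rw [Real.logb_pow]; exact_mod_cast h
  rw [Real.logb_le_iff_le_rpow (by norm_num) (by positivity)] at h2
  exact_mod_cast h2

lemma entropy_le {Ω : Type} [Fintype Ω] (μ : Ω → ℝ) (hμ : IsDist μ) {n m : ℕ} (X : Ω → BS n)
    (hX : minEntropyGe (distMap X μ) (6 * m)) : 6 * m ≤ n := by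
  have h1 := (isDist_distMap X μ hμ).2
  have h2 : ∑ x, distMap X μ x ≤ ∑ x : BS n, (2 : ℝ) ^ (-(6 * m : ℝ)) :=
    Finset.sum_le_sum (fun x _ => hX x)
  rw [h1] at h2
  simp only [Finset.sum_const, Finset.card_univ, nsmul_eq_mul, Fintype.card_fun, Fintype.card_bool,
    Fintype.card_fin, Nat.cast_pow, Nat.cast_ofNat] at h2
  rw [Real.rpow_neg (by norm_num), ← div_eq_mul_inv, le_div_iff₀ (by positivity), one_mul] at h2
  have h3 : (2 : ℝ) ^ (6 * m) ≤ 2 ^ n := by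
    have : (2 : ℝ) ^ (6 * m : ℝ) = 2 ^ (6 * m) := by
      rw [← Real.rpow_natCast]; push_cast; rfl
    rwa [this] at h2
  exact (pow_le_pow_iff_right₀ (by norm_num)).1 h3

lemma two_pow_le_exp (a : ℕ) : (2 : ℝ) ^ a ≤ Real.exp a := by
  have h : (2 : ℝ) ≤ Real.exp 1 := by
    have := Real.add_one_le_exp (1 : ℝ); linarith
  calc (2 : ℝ) ^ a ≤ (Real.exp 1) ^ a := pow_le_pow_left₀ (by norm_num) h a
    _ = _ := by rw [← Real.exp_nat_mul, mul_one]

theorem main_exists (ε : ℝ) (hε : 0 < ε) (L m n d : ℕ) (hLε : L * ε < 1) (hL : 1 ≤ L)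
    (hm : 1 ≤ m) (hn : 6 * m ≤ n) (hmd : 6 * log2 (d / ε) ≤ (m : ℝ))
    (hdn : 6 * log2 (n / ε) ≤ (d : ℝ)) :
    ∃ K : ℕ, 0 < K ∧ (∃ F : ((Fin L → BS m) × BS n) × BS d → BS m,
      ∀ (g : BS d → BS d) (T : BS d → BS m → BS m → Bool)
      (v : Fin K → ((Fin L → BS m) × BS n) × ((Fin L → BS m) × BS n)),
      Function.Injective (fun k => (v k).1) → (∀ k k', (v k).2 ≠ (v k').1) →
      ∑ k, dev F g T (v k).1 (v k).2 ≤ ε * (K * Fintype.card (BS d))) ∧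
      ε + 1 / 2 ^ m + (m * 2) * (K * (2 : ℝ) ^ (-(6 * m : ℝ))) ≤ 36 * L * ε := by
  have hLr : (1 : ℝ) ≤ L := by exact_mod_cast hL
  have hε1 : ε < 1 := by nlinarith
  have hmr : (1 : ℝ) ≤ m := by exact_mod_cast hm
  have hnm : (6 : ℝ) * m ≤ n := by exact_mod_cast hn
  have hnr : (6 : ℝ) ≤ n := by linarith
  have hD := pow_of_log (n / ε) (by positivity) d hdn
  set D : ℝ := (2 : ℝ) ^ d with hDdef
  have hnε : (6 : ℝ) ≤ n / ε := by
    rw [le_div_iff₀ hε]; nlinarith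
  have hd : 1 ≤ d := by
    by_contra h0
    have : d = 0 := by omega
    have hD1 : D = 1 := by rw [hDdef, this]; norm_num
    have : (6 : ℝ) ^ 6 ≤ (n / ε) ^ 6 := pow_le_pow_left₀ (by norm_num) hnε 6
    norm_num at this
    linarith
  have hdr : (1 : ℝ) ≤ d := by exact_mod_cast hd
  have hM := pow_of_log (d / ε) (by positivity) m hmd
  set M : ℝ := (2 : ℝ) ^ m with hMdef
  have hdε : (1 : ℝ) ≤ d / ε := by
    rw [le_div_iff₀ hε]; linarith
  have hdM' : d / ε ≤ M := (le_self_pow₀ hdε (by norm_num)).trans hM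
  have hdM : (d : ℝ) ≤ M := by
    refine le_trans ?_ hdM'
    rw [le_div_iff₀ hε]; nlinarith
  have hMε : 1 / ε ≤ M := by
    refine le_trans ?_ hdM'
    gcongr
  have hM1 : 1 ≤ M := hdr.trans hdM
  have hmM : (m : ℝ) ≤ M := by
    have : m < 2 ^ m := Nat.lt_two_pow_self
    have : (m : ℝ) < 2 ^ m := by exact_mod_cast this
    exact this.le
  set K : ℕ := ⌊8 * (d + M ^ 2) / ε ^ 2⌋₊ + 1 with hK
  have hK1 : 8 * (d + M ^ 2) / ε ^ 2 < K := by
    rw [hK]; push_cast; exact Nat.lt_floor_add_one _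
  have hK2 : (K : ℝ) ≤ 8 * (d + M ^ 2) / ε ^ 2 + 1 := by
    rw [hK]; push_cast
    have := Nat.floor_le (a := 8 * (d + M ^ 2) / ε ^ 2) (by positivity)
    linarith
  have hε2 : ε ^ 2 ≤ 1 := pow_le_one₀ hε.le hε1.le
  have hK3 : (K : ℝ) * ε ^ 2 ≤ 17 * M ^ 2 := by
    have h1 : (K : ℝ) * ε ^ 2 ≤ (8 * (d + M ^ 2) / ε ^ 2 + 1) * ε ^ 2 :=
      mul_le_mul_of_nonneg_right hK2 (by positivity)
    have h2 : (8 * (d + M ^ 2) / ε ^ 2 + 1) * ε ^ 2 = 8 * (d + M ^ 2) + ε ^ 2 := by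
      field_simp
    nlinarith
  have hK4 : 8 * (d + M ^ 2) < K * ε ^ 2 := by
    rwa [div_lt_iff₀ (by positivity)] at hK1
  refine ⟨K, by omega, ?_, ?_⟩
  · apply exists_F ε hε hε1.le K
    have hcard : (Fintype.card ((BS d → BS d) × (BS d → BS m → BS m → Bool) ×
        (Fin K → ((Fin L → BS m) × BS n) × ((Fin L → BS m) × BS n))) : ℝ) =
        2 ^ (d * 2 ^ d + 2 ^ m * 2 ^ m * 2 ^ d + 2 * (m * L + n) * K) := by
      simp only [Fintype.card_prod, Fintype.card_fun, Fintype.card_bool, Fintype.card_fin]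
      push_cast
      simp only [← pow_mul, ← pow_add]
      congr 1
      ring
    rw [hcard]
    refine (two_pow_le_exp _).trans_lt ?_
    apply Real.exp_lt_exp.2
    simp only [Fintype.card_fun, Fintype.card_bool, Fintype.card_fin]
    push_cast
    rw [← hDdef, ← hMdef]
    have hN : 16 * ((m : ℝ) * L + n) ≤ ε ^ 2 * D := by
      have h1 : (m : ℝ) * L + n ≤ 2 * (n / ε) := by
        have : (m : ℝ) * L ≤ n / ε := by
          rw [le_div_iff₀ hε]; nlinarith
        have : (n : ℝ) ≤ n / ε := by
          rw [le_div_iff₀ hε]; nlinarith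
        linarith
      have h2 : ε ^ 2 * (n / ε) ^ 6 ≤ ε ^ 2 * D := mul_le_mul_of_nonneg_left hD (by positivity)
      have h3 : ε ^ 2 * (n / ε) ^ 6 = (n : ℝ) ^ 2 * (n / ε) ^ 4 := by
        field_simp
      have h4 : (6 : ℝ) ^ 3 ≤ (n / ε) ^ 3 := pow_le_pow_left₀ (by norm_num) hnε 3
      have h5 : (1 : ℝ) ≤ (n : ℝ) ^ 2 := one_le_pow₀ (by linarith)
      have h6 : 6 ^ 3 * (n / ε) ≤ (n / ε) ^ 4 := by
        calc _ ≤ (n / ε) ^ 3 * (n / ε) := mul_le_mul_of_nonneg_right h4 (by positivity)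
          _ = _ := by ring
      have h7 : (n / ε) ^ 4 ≤ (n : ℝ) ^ 2 * (n / ε) ^ 4 := le_mul_of_one_le_left (by positivity) h5
      linarith
    have hDpos : 0 < D := by positivity
    have e1 : (d + M ^ 2) * D < (K * ε ^ 2 / 8) * D := by
      apply mul_lt_mul_of_pos_right _ hDpos
      linarith
    have e2 : (16 * ((m : ℝ) * L + n)) * K ≤ ε ^ 2 * D * K :=
      mul_le_mul_of_nonneg_right hN (by positivity)
    nlinarith
  · have hr : (2 : ℝ) ^ (-(6 * m : ℝ)) = 1 / M ^ 6 := by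
      rw [Real.rpow_neg (by norm_num), one_div, hMdef, ← pow_mul]
      congr 1
      rw [← Real.rpow_natCast]
      push_cast
      congr 1
      ring
    rw [hr]
    have hMε' : 1 ≤ ε * M := by
      rw [div_le_iff₀ hε] at hMε; linarith
    have a1 : 1 / M ≤ ε := by
      rw [div_le_iff₀ (by linarith)]; exact hMε'
    have a2 : (m * 2) * (K * (1 / M ^ 6)) ≤ 34 * ε := by
      have b : (m * 2) * (K * (1 / M ^ 6)) = (m * 2 * K) / M ^ 6 := by ring
      rw [b, div_le_iff₀ (by positivity)]
      have hε2p : 0 < ε ^ 2 := by positivity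
      apply le_of_mul_le_mul_right _ hε2p
      have b1 : m * 2 * K * ε ^ 2 ≤ 34 * M ^ 3 := by
        calc m * 2 * K * ε ^ 2 = (2 * m) * (K * ε ^ 2) := by ring
          _ ≤ (2 * M) * (17 * M ^ 2) := by gcongr
          _ = _ := by ring
      have b2 : 1 ≤ (ε * M) ^ 3 := one_le_pow₀ hMε'
      calc _ ≤ 34 * M ^ 3 * 1 := by rw [mul_one]; exact b1
        _ ≤ 34 * M ^ 3 * (ε * M) ^ 3 := mul_le_mul_of_nonneg_left b2 (by positivity)
        _ = _ := by ring
    nlinarith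

end helpers


theorem stmt14 :
    ∃ c C : ℝ, 1 < c ∧ 0 < C ∧
      ∀ ε : ℝ, 0 < ε → ∀ ℓ L m n d : ℕ, L = 2 ^ ℓ →
        c * log2 (d / ε) ≤ (m : ℝ) → c * log2 (n / ε) ≤ (d : ℝ) →
        ∃ NIPM : (Fin L → BS m) → BS n → (Fin ℓ → BS d) → BS m,
          -- the property: over any finite joint probability space Ω, with Y, Y' taking
          -- values in any finite type τ
          ∀ (Ω : Type) [Fintype Ω] (τ : Type) [Fintype τ] [DecidableEq τ]
            (μ : Ω → ℝ), IsDist μ →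
            ∀ (V V' : Ω → Fin L → BS m) (X X' : Ω → BS n) (Y Y' : Ω → τ)
              (Yf Yf' : τ → Fin ℓ → BS d),
              -- every row of V is uniform
              (∀ i : Fin L, distMap (fun ω => V ω i) μ = unifDist (BS m)) →
              -- some row h : (V_h, V'_h) = (U_m, V'_h)
              (∃ h : Fin L, distMap (fun ω => (V ω h, V' ω h)) μ
                  = prodDist (unifDist (BS m)) (distMap (fun ω => V' ω h) μ)) →
              -- H∞(X) ≥ 6m
              minEntropyGe (distMap X μ) (6 * m) →
              -- look-ahead property of (Y_1,…,Y_ℓ) = Yf(Y), (Y'_1,…,Y'_ℓ) = Yf'(Y')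
              (∀ j : Fin ℓ,
                distMap (fun ω => (Yf (Y ω) j,
                    fun i : Fin j.val =>
                      (Yf (Y ω) ⟨i.val, i.isLt.trans j.isLt⟩,
                       Yf' (Y' ω) ⟨i.val, i.isLt.trans j.isLt⟩))) μ
                  = prodDist (unifDist (BS d))
                      (distMap (fun ω =>
                        fun i : Fin j.val =>
                          (Yf (Y ω) ⟨i.val, i.isLt.trans j.isLt⟩,
                           Yf' (Y' ω) ⟨i.val, i.isLt.trans j.isLt⟩)) μ)) →
              -- (V, V', X, X') independent of (Y, Y')
              (distMap (fun ω => ((V ω, V' ω, X ω, X' ω), (Y ω, Y' ω))) μ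
                  = prodDist (distMap (fun ω => (V ω, V' ω, X ω, X' ω)) μ)
                      (distMap (fun ω => (Y ω, Y' ω)) μ)) →
              -- conclusion: (W, W', Y, Y') ≈_{C·L·ε} (U_m, W', Y, Y')
              sd (distMap (fun ω =>
                    (NIPM (V ω) (X ω) (fun j => Yf (Y ω) j),
                     NIPM (V' ω) (X' ω) (fun j => Yf' (Y' ω) j), Y ω, Y' ω)) μ)
                 (distMap (fun p : BS m × Ω =>
                    (p.1, NIPM (V' p.2) (X' p.2) (fun j => Yf' (Y' p.2) j), Y p.2, Y' p.2))
                    (prodDist (unifDist (BS m)) μ)) ≤ C * L * ε := by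
  classical
  refine ⟨6, 36, by norm_num, by norm_num, ?_⟩
  intro ε hε ℓ L m n d hL hmd hdn
  have hL1 : 1 ≤ L := by rw [hL]; exact Nat.one_le_two_pow
  have hLr : (1 : ℝ) ≤ L := by exact_mod_cast hL1
  by_cases hbig : 1 ≤ L * ε
  · refine ⟨fun _ _ _ => default, ?_⟩
    intro Ω _ τ _ _ μ hμ V V' X X' Y Y' Yf Yf' _ _ _ _ _
    refine (sd_le_one _ _ (isDist_distMap _ _ hμ)
      (isDist_distMap _ _ (isDist_prod _ _ isDist_unif hμ))).trans ?_
    nlinarith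
  push Not at hbig
  by_cases hm : m = 0
  · subst hm
    refine ⟨fun _ _ _ => default, ?_⟩
    intro Ω _ τ _ _ μ hμ V V' X X' Y Y' Yf Yf' _ _ _ _ hind
    have hform := sd_formula (B := BS 0) μ (fun ω => (V ω, V' ω, X ω, X' ω)) Y Y' hind
      (isDist_distMap _ μ hμ).1 (fun _ _ => default) (fun _ _ => default)
    refine hform.le.trans ?_
    have hsub : ∀ a b : BS 0, a = b := fun a b => Subsingleton.elim a b
    have h0 : ∀ w : BS 0 × BS 0, ∑ ω, μ ω * (((if (default : BS 0) = w.1 then 1 else 0) - 1 / (Fintype.card (BS 0) : ℝ)) *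
        (if (default : BS 0) = w.2 then 1 else 0)) = 0 := by
      intro w
      apply Finset.sum_eq_zero
      intro ω _
      rw [if_pos (hsub _ _)]
      simp
    simp only [h0]
    simp
    positivity
  by_cases hn : 6 * m ≤ n
  swap
  · refine ⟨fun _ _ _ => default, ?_⟩
    intro Ω _ τ _ _ μ hμ V V' X X' Y Y' Yf Yf' _ _ hX _ _
    exact absurd (entropy_le μ hμ X hX) hn
  rcases Nat.eq_zero_or_pos ℓ with hℓ | hℓ
  · subst hℓ
    have hL' : L = 1 := by simpa using hL
    subst hL'
    refine ⟨fun V _ _ => V 0, ?_⟩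
    intro Ω _ τ _ _ μ hμ V V' X X' Y Y' Yf Yf' _ hh _ _ hind
    obtain ⟨h, hh⟩ := hh
    have h00 : h = 0 := Subsingleton.elim _ _
    subst h00
    have hform := sd_formula (B := BS m) μ (fun ω => (V ω, V' ω, X ω, X' ω)) Y Y' hind
      (isDist_distMap _ μ hμ).1 (fun a _ => a.1 0) (fun a _ => a.2.1 0)
    refine hform.le.trans ?_
    have h0 : ∀ w : BS m × BS m, ∑ ω, μ ω * (((if V ω 0 = w.1 then 1 else 0) - 1 / (Fintype.card (BS m) : ℝ)) *
        (if V' ω 0 = w.2 then 1 else 0)) = 0 := by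
      intro w
      have h1 := congrFun hh w
      simp only [prodDist, unifDist] at h1
      rw [distMap_eq, distMap_eq, Finset.mul_sum] at h1
      rw [← sub_eq_zero, ← Finset.sum_sub_distrib] at h1
      refine Eq.trans ?_ h1
      apply Finset.sum_congr rfl
      intro ω _
      obtain ⟨w, w'⟩ := w
      simp only [Prod.mk.injEq]
      by_cases hw : V ω 0 = w <;> by_cases hw' : V' ω 0 = w' <;>
        simp only [hw, hw', and_self, and_true, and_false, if_true, if_false] <;> ring
    simp only [h0]
    simp
    positivity
  · obtain ⟨K, hK, ⟨F, hF⟩, hfin⟩ := main_exists ε hε L m n d hbig hL1 (by omega) hn hmd hdn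
    refine ⟨fun V X Ys => F ((V, X), Ys ⟨0, hℓ⟩), ?_⟩
    intro Ω _ τ _ _ μ hμ V V' X X' Y Y' Yf Yf' _ hh hX hlook hind
    obtain ⟨h, hh⟩ := hh
    refine le_trans ?_ hfin
    refine analysis ε hε hK F hF μ hμ V V' X X' Y Y' (fun t => Yf t ⟨0, hℓ⟩)
      (fun t => Yf' t ⟨0, hℓ⟩) h hh hX ?_ hind
    intro s
    have h1 := congrFun (hlook ⟨0, hℓ⟩) (s, fun i => i.elim0)
    simp only [prodDist, unifDist] at h1
    rw [distMap_eq, distMap_eq] at h1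
    rw [distMap_eq]
    have hsub : ∀ a b : Fin 0 → BS d × BS d, a = b := fun a b => Subsingleton.elim a b
    have e2 : ∀ ω, ((fun i : Fin 0 => (Yf (Y ω) ⟨i.val, i.isLt.trans hℓ⟩,
        Yf' (Y' ω) ⟨i.val, i.isLt.trans hℓ⟩)) = fun i : Fin 0 => i.elim0) := fun ω => hsub _ _
    simp only [Prod.mk.injEq, e2, and_true, if_true, mul_one, hμ.2] at h1
    exact h1
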